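/- For every NDPM M with p pointers, there exists an NDPM M' with p pointers such that in every transition of M' at most one pointer receives an instruction other than 'stay' (at most one pointer moves per transition), and M' decides exactly the same sets of binary words as M: a set S is decided by M if and only if it is decided by M'. -/

import Mathlib

/-- A pointer instruction: move one step forward, one step backward, or stay. -/
inductive Move : Type
  | forward
  | backward
  | stay
deriving DecidableEq

/-- A non-deterministic pointer machine (NDPM) with `p` pointers: a finite set `Q` of
states together with a transition relation from pseudo-configurations (the last values
read by the `p` pointers — `none` denoting `⋆` — and the current state) to either a
tuple of instructions and a new state (`Sum.inl`), or `accept` (`Sum.inr true`) /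
`reject` (`Sum.inr false`). -/
structure NDPM (p : ℕ) : Type 1 where
  Q : Type
  finQ : Fintype Q
  trans : ((Fin p → Option Bool) × Q) → (((Fin p → Move) × Q) ⊕ Bool) → Prop

/-- A configuration of an NDPM with `p` pointers and state set `Q`: the `p` pointer
positions, the `p` stored values (`none` = `⋆`), and the current state. -/
structure PConfig (p : ℕ) (Q : Type) : Type where
  pos : Fin p → ℕ
  val : Fin p → Option Bool
  state : Q

/-- The symbol held at position `pos` of the circular tape `⋆a₁…a_k` for the input
word `w = a₁…a_k` (positions are taken modulo `k+1`; position `0` holds `⋆ = none`). -/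
def tapeSym (w : List Bool) (pos : ℕ) : Option Bool :=
  if pos % (w.length + 1) = 0 then none else w[(pos % (w.length + 1)) - 1]?

/-- The new position after applying an instruction, on a circular tape of length `k+1`. -/
def movePos (k : ℕ) (pos : ℕ) : Move → ℕ
  | Move.forward => (pos + 1) % (k + 1)
  | Move.backward => (pos + k) % (k + 1)
  | Move.stay => pos

/-- One (non-terminal) computation step of the machine `M` on input word `w`: some
transition applies to the pseudo-configuration of `c`, each pointer moves according
to its instruction, and the stored value of each pointer that moved is updated to the
symbol at its new position. -/
def NDPM.Step {p : ℕ} (M : NDPM p) (w : List Bool) (c c' : PConfig p M.Q) : Prop :=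
  ∃ (mv : Fin p → Move) (q' : M.Q),
    M.trans (c.val, c.state) (Sum.inl (mv, q')) ∧
    c'.state = q' ∧
    (∀ i, c'.pos i = movePos w.length (c.pos i) (mv i)) ∧
    (∀ i, c'.val i =
      if mv i = Move.stay then c.val i
      else tapeSym w (movePos w.length (c.pos i) (mv i)))

/-- The initial configuration of `M_c(w)`: all pointers at position `0`, stored values
and state given by the pseudo-configuration `c`. -/
def NDPM.initConfig {p : ℕ} (M : NDPM p) (c : (Fin p → Option Bool) × M.Q) :
    PConfig p M.Q :=
  ⟨fun _ => 0, c.1, c.2⟩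

/-- `M_c(w)` has an infinite branch: an infinite sequence of configurations starting at
the initial configuration, each related to the next by a computation step. -/
def NDPM.InfiniteBranch {p : ℕ} (M : NDPM p) (c : (Fin p → Option Bool) × M.Q)
    (w : List Bool) : Prop :=
  ∃ f : ℕ → PConfig p M.Q, f 0 = M.initConfig c ∧ ∀ n, M.Step w (f n) (f (n + 1))

/-- `M_c(w)` rejects: some branch reaches a configuration from which a transition to
`reject` applies. -/
def NDPM.Rejects {p : ℕ} (M : NDPM p) (c : (Fin p → Option Bool) × M.Q)
    (w : List Bool) : Prop :=
  ∃ d : PConfig p M.Q, Relation.ReflTransGen (M.Step w) (M.initConfig c) d ∧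
    M.trans (d.val, d.state) (Sum.inr false)

/-- `M_c(w)` accepts: every maximal branch is finite and ends in `accept`, i.e. there
is no infinite branch and no branch ever reaches a transition to `reject` (recall that
a branch to which no transition applies ends in `accept` by default). -/
def NDPM.Accepts {p : ℕ} (M : NDPM p) (c : (Fin p → Option Bool) × M.Q)
    (w : List Bool) : Prop :=
  ¬ M.InfiniteBranch c w ∧ ¬ M.Rejects c w

/-- `M` decides the set `S` of binary words: for some pseudo-configuration `c`,
`M_c(w)` accepts exactly the words `w ∈ S`. -/
def NDPM.Decides {p : ℕ} (M : NDPM p) (S : Set (List Bool)) : Prop :=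
  ∃ c : (Fin p → Option Bool) × M.Q, ∀ w : List Bool, M.Accepts c w ↔ w ∈ S

/-- `M` is acyclic: for every pseudo-configuration and every input word, every branch
of the computation tree is finite. -/
def NDPM.Acyclic {p : ℕ} (M : NDPM p) : Prop :=
  ∀ (c : (Fin p → Option Bool) × M.Q) (w : List Bool), ¬ M.InfiniteBranch c w


namespace OneMove

instance : Fintype Move :=
  ⟨{Move.forward, Move.backward, Move.stay}, fun x => by cases x <;> simp⟩

/-- Work data: current pointer, simulated values, lift bits, instructions, next state. -/
structure WD (n : ℕ) (Q : Type) : Type where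
  i : Fin (n + 2)
  e : Fin (n + 2) → Option Bool
  l : Fin (n + 2) → Bool
  mv : Fin (n + 2) → Move
  q : Q

/-- States of the simulating machine. -/
inductive St (n : ℕ) (Q : Type) : Type
  | boot (e : Fin (n + 2) → Option Bool) (q : Q)
  | l1 (e : Fin (n + 2) → Option Bool) (mv : Fin (n + 2) → Move) (q : Q)
  | lift (d : WD n Q)
  | w0 (d : WD n Q)
  | w1 (d : WD n Q)
  | w2 (d : WD n Q)
  | w3 (d : WD n Q)
  | w4 (d : WD n Q)
  | node (e : Fin (n + 2) → Option Bool) (l : Fin (n + 2) → Bool) (q : Q)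

variable {n : ℕ} {Q : Type}

theorem finite_WD [Finite Q] : Finite (WD n Q) := by
  refine Finite.of_injective
    (fun d : WD n Q => (d.i, d.e, d.l, d.mv, d.q)) ?_
  rintro ⟨⟩ ⟨⟩ h
  simpa using h

theorem finite_St [Finite Q] : Finite (St n Q) := by
  have := finite_WD (n := n) (Q := Q)
  let f : St n Q → Fin 9 × Option (WD n Q) := fun s => match s with
    | .boot e q => (0, some ⟨0, e, fun _ => true, fun _ => .stay, q⟩)
    | .l1 e mv q => (1, some ⟨0, e, fun _ => true, mv, q⟩)
    | .lift d => (2, some d)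
    | .w0 d => (3, some d)
    | .w1 d => (4, some d)
    | .w2 d => (5, some d)
    | .w3 d => (6, some d)
    | .w4 d => (7, some d)
    | .node e l q => (8, some ⟨0, e, l, fun _ => .stay, q⟩)
  refine Finite.of_injective f ?_
  intro a b h
  cases a <;> cases b <;> simp [f] at h ⊢ <;> exact h

/-- Simulated values after applying instructions on the empty word. -/
def eps (e : Fin (n + 2) → Option Bool) (mv : Fin (n + 2) → Move) : Fin (n + 2) → Option Bool :=
  fun i => if mv i = .stay then e i else none

def nextLift (d : WD n Q) : St n Q :=
  if h : d.i.1 + 1 < n + 2 then .lift { d with i := ⟨d.i.1 + 1, h⟩ }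
  else .w0 { d with i := 0 }

def nextPtr (d : WD n Q) : St n Q :=
  if h : d.i.1 + 1 < n + 2 then .w0 { d with i := ⟨d.i.1 + 1, h⟩ }
  else .node d.e d.l d.q

/-- Data after finishing the current pointer, which has just read `a`. -/
def upd (d : WD n Q) (a : Option Bool) : WD n Q :=
  { d with
    e := fun j => if j = d.i then (if d.mv d.i = .stay then d.e d.i else a) else d.e j
    l := fun j => if j = d.i then decide (a = none) else d.l j }

/-- Transitions of the simulating machine, moving the single pointer `i` by `m`. -/
def tr (T : (Fin (n + 2) → Option Bool) × Q → (Fin (n + 2) → Move) × Q → Prop)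
    (v : Fin (n + 2) → Option Bool) (s : St n Q) (i : Fin (n + 2)) (m : Move) (s' : St n Q) : Prop :=
  match s with
  | .boot e q => ∃ mv q', T (e, q) (mv, q') ∧ i = 0 ∧ m = .forward ∧ s' = .l1 e mv q'
  | .l1 e mv q => i = 0 ∧ m = .stay ∧
      s' = if v 0 = none then .boot (eps e mv) q else .lift ⟨1, e, fun _ => true, mv, q⟩
  | .lift d => d.i ≠ 0 ∧ i = d.i ∧ m = .forward ∧ s' = nextLift d
  | .w0 d => i = d.i ∧ m = .forward ∧ s' = .w1 d
  | .w1 d => i = d.i ∧ m = .backward ∧ s' = .w2 d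
  | .w2 d => v d.i ≠ none ∧ i = d.i ∧ m = (if d.l d.i then .backward else .stay) ∧ s' = .w3 d
  | .w3 d => i = d.i ∧ m = d.mv d.i ∧ s' = .w4 d
  | .w4 d => i = d.i ∧ m = (if v d.i = none then .forward else .stay) ∧
      s' = nextPtr (upd d (v d.i))
  | .node e l q => ∃ mv q', T (e, q) (mv, q') ∧ i = 0 ∧ m = .stay ∧ s' = .w0 ⟨0, e, l, mv, q'⟩

def single (i : Fin (n + 2)) (m : Move) : Fin (n + 2) → Move := fun j => if j = i then m else .stay

/-- The simulating machine. -/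
noncomputable def sim (M : NDPM (n + 2)) : NDPM (n + 2) where
  Q := St n M.Q
  finQ := by
    have := M.finQ
    have := finite_St (n := n) (Q := M.Q)
    exact Fintype.ofFinite _
  trans := fun pc t => match t with
    | .inl (mv, s') => ∃ i m, mv = single i m ∧
        tr (fun a b => M.trans a (.inl b)) pc.1 pc.2 i m s'
    | .inr _ => False

def app (w : List Bool) {Q' : Type} (c : PConfig (n + 2) Q) (i : Fin (n + 2)) (m : Move) (s' : Q') :
    PConfig (n + 2) Q' where
  pos := fun j => if j = i then movePos w.length (c.pos i) m else c.pos j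
  val := fun j => if j = i ∧ m ≠ .stay then tapeSym w (movePos w.length (c.pos i) m) else c.val j
  state := s'

def mapp {p : ℕ} (w : List Bool) (c : PConfig p Q) (mv : Fin p → Move) (q' : Q) :
    PConfig p Q where
  pos := fun j => movePos w.length (c.pos j) (mv j)
  val := fun j => if mv j = .stay then c.val j else tapeSym w (movePos w.length (c.pos j) (mv j))
  state := q'

theorem PConfig_ext {p : ℕ} {c c' : PConfig p Q} (h1 : ∀ i, c.pos i = c'.pos i)
    (h2 : ∀ i, c.val i = c'.val i) (h3 : c.state = c'.state) : c = c' := by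
  cases c; cases c'; simp at *; exact ⟨funext h1, funext h2, h3⟩

theorem step_iff {p : ℕ} (M : NDPM p) (w : List Bool) (c c' : PConfig p M.Q) :
    M.Step w c c' ↔ ∃ mv q', M.trans (c.val, c.state) (.inl (mv, q')) ∧ c' = mapp w c mv q' := by
  constructor
  · rintro ⟨mv, q', h, h1, h2, h3⟩
    exact ⟨mv, q', h, PConfig_ext h2 h3 h1⟩
  · rintro ⟨mv, q', h, rfl⟩
    exact ⟨mv, q', h, rfl, fun _ => rfl, fun _ => rfl⟩

theorem mapp_single (w : List Bool) (c : PConfig (n + 2) Q) (i : Fin (n + 2)) (m : Move) (s : Q) :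
    mapp w c (single i m) s = app w c i m s := by
  apply PConfig_ext
  · intro j
    by_cases h : j = i
    · subst h; simp [mapp, app, single]
    · simp [mapp, app, single, h, movePos]
  · intro j
    by_cases h : j = i
    · subst h; by_cases hm : m = .stay <;> simp [mapp, app, single, hm]
    · simp [mapp, app, single, h]
  · rfl

abbrev SC (M : NDPM (n + 2)) := PConfig (n + 2) (St n M.Q)

def SStep (M : NDPM (n + 2)) (w : List Bool) (c c' : SC M) : Prop := (sim M).Step w c c'

theorem sstep_iff (M : NDPM (n + 2)) (w : List Bool) (c c' : SC M) :
    SStep M w c c' ↔ ∃ i m s', tr (fun a b => M.trans a (.inl b)) c.val c.state i m s' ∧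
      c' = app w c i m s' := by
  refine (step_iff (sim M) w c c').trans ?_
  constructor
  · rintro ⟨mv, s', ⟨i, m, rfl, h⟩, rfl⟩
    exact ⟨i, m, s', h, mapp_single w (Q := St n M.Q) c i m s'⟩
  · rintro ⟨i, m, t, h, rfl⟩
    exact ⟨single i m, t, ⟨i, m, rfl, h⟩, (mapp_single w (Q := St n M.Q) c i m t).symm⟩

/-- No infinite branch from `c`. -/
def Halts {p : ℕ} (M : NDPM p) (w : List Bool) (c : PConfig p M.Q) : Prop :=
  Acc (fun a b => M.Step w b a) c

theorem accepts_iff {p : ℕ} (M : NDPM p) (hM : ∀ pc, ¬ M.trans pc (.inr false)) (c w) :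
    M.Accepts c w ↔ Halts M w (M.initConfig c) := by
  unfold NDPM.Accepts NDPM.InfiniteBranch NDPM.Rejects Halts
  rw [acc_iff_isEmpty_descending_chain]
  constructor
  · rintro ⟨h, -⟩
    exact ⟨fun f => h ⟨f.1, f.2.1, f.2.2⟩⟩
  · rintro ⟨h⟩
    exact ⟨fun ⟨f, h1, h2⟩ => h ⟨f, h1, h2⟩, fun ⟨d, _, h2⟩ => hM _ h2⟩

def SHalts (M : NDPM (n + 2)) (w : List Bool) (c : SC M) : Prop :=
  Acc (fun a b => SStep M w b a) c

def Det (M : NDPM (n + 2)) (w : List Bool) (c c' : SC M) : Prop :=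
  ∀ c'', SStep M w c c'' ↔ c'' = c'

def Path (M : NDPM (n + 2)) (w : List Bool) : SC M → SC M → Prop :=
  Relation.ReflTransGen (Det M w)

theorem path_halts {M : NDPM (n + 2)} {w : List Bool} {c c' : SC M} (h : Path M w c c') :
    SHalts M w c' → SHalts M w c := by
  intro h'
  induction h using Relation.ReflTransGen.head_induction_on with
  | refl => exact h'
  | head h1 _ ih => exact ⟨_, fun y hy => by rw [(h1 y).1 hy]; exact ih⟩

theorem halts_of_path {M : NDPM (n + 2)} {w : List Bool} {c c' : SC M} (h : Path M w c c') :
    SHalts M w c → SHalts M w c' := by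
  intro h'
  induction h using Relation.ReflTransGen.head_induction_on with
  | refl => exact h'
  | head h1 _ ih => exact ih (h'.inv ((h1 _).2 rfl))

theorem bisim {M : NDPM (n + 2)} {w : List Bool} (R : PConfig (n + 2) M.Q → SC M → Prop)
    (h1 : ∀ x z x', R x z → M.Step w x x' → ∃ c z', SStep M w z c ∧ Path M w c z' ∧ R x' z')
    (h2 : ∀ x z c, R x z → SStep M w z c → ∃ x' z', M.Step w x x' ∧ Path M w c z' ∧ R x' z')
    (x z) (hR : R x z) : Halts M w x ↔ SHalts M w z := by
  constructor
  · intro hx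
    induction hx generalizing z with
    | intro x _ ih =>
      refine ⟨_, fun c hc => ?_⟩
      obtain ⟨x', z', hs, hp, hr⟩ := h2 x z c hR hc
      exact path_halts hp (ih x' hs z' hr)
  · intro hz
    have key : ∀ z, SHalts M w z → ∀ z' x, Path M w z z' → R x z' → Halts M w x := by
      intro z hz
      induction hz with
      | intro z _ ih =>
        intro z' x hp hr
        rcases Relation.ReflTransGen.cases_head hp with rfl | ⟨b, hb, hp'⟩
        · refine ⟨_, fun x' hx' => ?_⟩
          obtain ⟨c, z', hs, hp, hr'⟩ := h1 x z x' hr hx'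
          exact ih c hs z' x' hp hr'
        · exact ih b ((hb b).2 rfl) z' x hp' hr
    exact key z hz z x .refl hR

/-! ### Arithmetic -/

theorem tapeSym_eq_none {w : List Bool} {z : ℕ} (hz : z < w.length + 1) :
    tapeSym w z = none ↔ z = 0 := by
  unfold tapeSym
  rw [Nat.mod_eq_of_lt hz]
  by_cases h : z = 0
  · simp [h]
  · simp [h]; omega

theorem movePos_lt {k z : ℕ} (m : Move) (hz : z < k + 1) : movePos k z m < k + 1 := by
  cases m <;> simp only [movePos]
  · exact Nat.mod_lt _ (by omega)
  · exact Nat.mod_lt _ (by omega)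
  · exact hz

theorem movePos_fb {k z : ℕ} (hz : z < k + 1) :
    movePos k (movePos k z .forward) .backward = z := by
  simp only [movePos]
  rw [Nat.mod_add_mod, show z + 1 + k = z + (k + 1) by ring, Nat.add_mod_right, Nat.mod_eq_of_lt hz]

theorem movePos_one_b {k : ℕ} : movePos k 1 .backward = 0 := by
  simp only [movePos]
  rw [add_comm 1 k, Nat.mod_self]

theorem movePos_zero_f {k : ℕ} (hk : 1 ≤ k) : movePos k 0 .forward = 1 := by
  simp only [movePos]
  exact Nat.mod_eq_of_lt (by omega)

/-! ### One-step lemmas -/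

section steps
variable {M : NDPM (n + 2)} {w : List Bool}

theorem det_l1 (c : SC M) (e mv q) (h : c.state = .l1 e mv q) :
    Det M w c (app w c 0 .stay (if c.val 0 = none then .boot (eps e mv) q
      else .lift ⟨1, e, fun _ => true, mv, q⟩)) := by
  intro c''; rw [sstep_iff, h]; simp [tr]

theorem det_lift (c : SC M) (d) (h : c.state = .lift d) (hd : d.i ≠ 0) :
    Det M w c (app w c d.i .forward (nextLift d)) := by
  intro c''; rw [sstep_iff, h]; simp [tr, hd]

theorem det_w0 (c : SC M) (d) (h : c.state = .w0 d) :
    Det M w c (app w c d.i .forward (.w1 d)) := by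
  intro c''; rw [sstep_iff, h]; simp [tr]

theorem det_w1 (c : SC M) (d) (h : c.state = .w1 d) :
    Det M w c (app w c d.i .backward (.w2 d)) := by
  intro c''; rw [sstep_iff, h]; simp [tr]

theorem det_w2 (c : SC M) (d) (h : c.state = .w2 d) (hv : c.val d.i ≠ none) :
    Det M w c (app w c d.i (if d.l d.i then .backward else .stay) (.w3 d)) := by
  intro c''; rw [sstep_iff, h]; simp [tr, hv]

theorem det_w3 (c : SC M) (d) (h : c.state = .w3 d) :
    Det M w c (app w c d.i (d.mv d.i) (.w4 d)) := by
  intro c''; rw [sstep_iff, h]; simp [tr]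

theorem det_w4 (c : SC M) (d) (h : c.state = .w4 d) :
    Det M w c (app w c d.i (if c.val d.i = none then .forward else .stay)
      (nextPtr (upd d (c.val d.i)))) := by
  intro c''; rw [sstep_iff, h]; simp [tr]

theorem halts_of_det {c c' : SC M} (h : Det M w c c') (hhalt : SHalts M w c') : SHalts M w c :=
  path_halts (.single h) hhalt

/-! ### Illegitimate starts halt -/

theorem bad_w2 (c : SC M) (d) (h : c.state = .w2 d) (hv : c.val d.i = none) : SHalts M w c := by
  refine ⟨_, fun y hy => ?_⟩
  rw [sstep_iff, h] at hy
  simp [tr, hv] at hy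

theorem bad_self (c : SC M) (d) (h : c.state = .w0 d) (h0 : c.pos d.i = 0) : SHalts M w c := by
  refine halts_of_det (det_w0 c d h) (halts_of_det (det_w1 _ d rfl) (bad_w2 _ d rfl ?_))
  simp only [app]
  simp [h0, movePos_fb, tapeSym]

theorem app_pos_ne (c : SC M) {i j : Fin (n + 2)} (m : Move) (s : St n M.Q) (h : j ≠ i) :
    (app w c i m s).pos j = c.pos j := by simp [app, h]

/-- If pointer `j` is at `0` and the next pointer's business is sure to halt, then so is
the current one. -/
theorem bad_ptr (j : Fin (n + 2)) (i : Fin (n + 2)) (hij : j ≠ i)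
    (hnext : ∀ (c : SC M) (d : WD n M.Q), d.i = i → c.state = nextPtr d → c.pos j = 0 → SHalts M w c)
    (c : SC M) (d : WD n M.Q) (hd : d.i = i) (h0 : c.pos j = 0)
    (h : c.state = .w0 d ∨ c.state = .w1 d ∨ c.state = .w2 d ∨ c.state = .w3 d ∨ c.state = .w4 d) :
    SHalts M w c := by
  subst hd
  have a4 : ∀ c : SC M, c.pos j = 0 → c.state = .w4 d → SHalts M w c := fun c h0 h =>
    halts_of_det (det_w4 c d h) (hnext _ (upd d (c.val d.i)) rfl rfl
      (by rw [app_pos_ne _ _ _ hij, h0]))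
  have a3 : ∀ c : SC M, c.pos j = 0 → c.state = .w3 d → SHalts M w c := fun c h0 h =>
    halts_of_det (det_w3 c d h) (a4 _ (by rw [app_pos_ne _ _ _ hij, h0]) rfl)
  have a2 : ∀ c : SC M, c.pos j = 0 → c.state = .w2 d → SHalts M w c := fun c h0 h => by
    by_cases hv : c.val d.i = none
    · exact bad_w2 c d h hv
    · exact halts_of_det (det_w2 c d h hv) (a3 _ (by rw [app_pos_ne _ _ _ hij, h0]) rfl)
  have a1 : ∀ c : SC M, c.pos j = 0 → c.state = .w1 d → SHalts M w c := fun c h0 h =>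
    halts_of_det (det_w1 c d h) (a2 _ (by rw [app_pos_ne _ _ _ hij, h0]) rfl)
  have a0 : ∀ c : SC M, c.pos j = 0 → c.state = .w0 d → SHalts M w c := fun c h0 h =>
    halts_of_det (det_w0 c d h) (a1 _ (by rw [app_pos_ne _ _ _ hij, h0]) rfl)
  rcases h with h | h | h | h | h
  exacts [a0 c h0 h, a1 c h0 h, a2 c h0 h, a3 c h0 h, a4 c h0 h]

theorem nextPtr_lt (d : WD n Q) (h : d.i.1 + 1 < n + 2) :
    nextPtr d = .w0 { d with i := ⟨d.i.1 + 1, h⟩ } := by simp [nextPtr, h]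

theorem nextPtr_last (d : WD n Q) (h : ¬ d.i.1 + 1 < n + 2) :
    nextPtr d = .node d.e d.l d.q := by simp [nextPtr, h]

theorem bad_le (j : Fin (n + 2)) : ∀ (k : ℕ) (c : SC M) (d : WD n M.Q), d.i.1 + k = j.1 →
    c.pos j = 0 → c.state = .w0 d → SHalts M w c := by
  intro k
  induction k with
  | zero =>
    intro c d hd h0 h
    have : d.i = j := Fin.ext (by simpa using hd)
    exact bad_self c d h (this ▸ h0)
  | succ k ih =>
    intro c d hd h0 h
    refine bad_ptr j d.i (by intro hh; rw [hh] at hd; omega) ?_ c d rfl h0 (.inl h)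
    intro c' d' hd' h' h0'
    have hj := j.2
    have hd2 : d'.i.1 + (k + 1) = j.1 := by rw [hd']; exact hd
    rw [nextPtr_lt d' (by omega)] at h'
    exact ih c' _ (by simp; omega) h0' h'

theorem bad_node (j : Fin (n + 2)) (c : SC M) (e l q) (h0 : c.pos j = 0)
    (h : c.state = .node e l q) : SHalts M w c := by
  refine ⟨_, fun y hy => ?_⟩
  rw [sstep_iff, h] at hy
  obtain ⟨i, m, s, ⟨mv, q', _, rfl, rfl, rfl⟩, rfl⟩ := hy
  refine bad_le j j.1 _ ⟨0, e, l, mv, q'⟩ (by simp) ?_ rfl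
  by_cases hj : j = 0 <;> simp [app, hj, movePos] <;> simpa [hj] using h0

theorem bad_gt (j : Fin (n + 2)) : ∀ (k : ℕ) (c : SC M) (d : WD n M.Q), d.i.1 + k = n + 1 →
    j.1 < d.i.1 → c.pos j = 0 → c.state = .w0 d → SHalts M w c := by
  intro k
  induction k with
  | zero =>
    intro c d hd hj h0 h
    refine bad_ptr j d.i (by rintro rfl; omega) ?_ c d rfl h0 (.inl h)
    intro c' d' hd' h' h0'
    rw [nextPtr_last d' (by rw [hd']; omega)] at h'
    exact bad_node j c' _ _ _ h0' h'
  | succ k ih =>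
    intro c d hd hj h0 h
    refine bad_ptr j d.i (by rintro rfl; omega) ?_ c d rfl h0 (.inl h)
    intro c' d' hd' h' h0'
    rw [nextPtr_lt d' (by rw [hd']; omega)] at h'
    exact ih c' _ (by simp [hd']; omega) (by simp [hd']; omega) h0' h'

theorem bad_w0 (j : Fin (n + 2)) (c : SC M) (d : WD n M.Q) (h0 : c.pos j = 0)
    (h : c.state = .w0 d) : SHalts M w c := by
  have := d.i.2
  rcases le_or_gt d.i.1 j.1 with hj | hj
  · exact bad_le j (j.1 - d.i.1) c d (by omega) h0 h
  · exact bad_gt j (n + 1 - d.i.1) c d (by omega) hj h0 h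

theorem bad_next (j : Fin (n + 2)) (c : SC M) (d : WD n M.Q)
    (h : c.state = nextPtr d) (h0 : c.pos j = 0) : SHalts M w c := by
  by_cases hd : d.i.1 + 1 < n + 2
  · rw [nextPtr_lt d hd] at h; exact bad_w0 j c _ h0 h
  · rw [nextPtr_last d hd] at h; exact bad_node j c _ _ _ h0 h

theorem bad_work (j : Fin (n + 2)) (c : SC M) (d : WD n M.Q) (hj : j ≠ d.i) (h0 : c.pos j = 0)
    (h : c.state = .w0 d ∨ c.state = .w1 d ∨ c.state = .w2 d ∨ c.state = .w3 d ∨ c.state = .w4 d) :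
    SHalts M w c :=
  bad_ptr j d.i hj (fun c d _ h h0 => bad_next j c d h h0) c d rfl h0 h

theorem bad_lift : ∀ (k : ℕ) (c : SC M) (d : WD n M.Q), d.i.1 + k = n + 1 →
    c.pos 0 = 0 → c.state = .lift d → SHalts M w c := by
  intro k
  induction k with
  | zero =>
    intro c d hd h0 h
    have hd0 : d.i ≠ 0 := by intro hh; rw [hh] at hd; simp at hd
    refine halts_of_det (det_lift c d h hd0) (bad_w0 0 _ { d with i := 0 } ?_ ?_)
    · rw [app_pos_ne _ _ _ hd0.symm, h0]
    · simp only [app, nextLift]; rw [dif_neg (by omega)]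
  | succ k ih =>
    intro c d hd h0 h
    by_cases hd0 : d.i = 0
    · refine ⟨_, fun y hy => ?_⟩
      rw [sstep_iff, h] at hy
      simp [tr, hd0] at hy
    have hlt : d.i.1 + 1 < n + 2 := by omega
    refine halts_of_det (det_lift c d h hd0) (ih _ { d with i := ⟨d.i.1 + 1, hlt⟩ } ?_ ?_ ?_)
    · simp; omega
    · rw [app_pos_ne _ _ _ (Ne.symm hd0), h0]
    · simp only [app, nextLift]; rw [dif_pos hlt]

theorem exists_ne_fin (i : Fin (n + 2)) : ∃ j, j ≠ i := exists_ne i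

/-! ### Legitimate simulation -/

/-- Relation between simulated position `x`, actual position `z` and lift bit. -/
def PR (k x z : ℕ) (l : Bool) : Prop :=
  z < k + 1 ∧ z ≠ 0 ∧ (if l then x = 0 ∧ z = 1 else x = z)

theorem ptr_path (hk : 1 ≤ w.length) (c : SC M) (d : WD n M.Q) (h : c.state = .w0 d) (x : ℕ)
    (hPR : PR w.length x (c.pos d.i) (d.l d.i)) :
    ∃ c' : SC M, Path M w c c' ∧
      c'.state = nextPtr (upd d (tapeSym w (movePos w.length x (d.mv d.i)))) ∧
      (∀ j, j ≠ d.i → c'.pos j = c.pos j) ∧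
      PR w.length (movePos w.length x (d.mv d.i)) (c'.pos d.i)
        (decide (tapeSym w (movePos w.length x (d.mv d.i)) = none)) := by
  obtain ⟨hz, hz0, hx⟩ := hPR
  set k := w.length with hkdef
  have hxlt : x < k + 1 := by
    split_ifs at hx
    · omega
    · omega
  set c1 : SC M := app w c d.i .forward (.w1 d) with hc1
  set c2 : SC M := app w c1 d.i .backward (.w2 d) with hc2
  have p1 : c1.pos d.i = movePos k (c.pos d.i) .forward := by simp [hc1, app, hkdef]
  have p2 : c2.pos d.i = c.pos d.i := by
    have : c2.pos d.i = movePos k (c1.pos d.i) .backward := by simp [hc2, app, hkdef]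
    rw [this, p1, movePos_fb hz]
  have v2 : c2.val d.i = tapeSym w (c.pos d.i) := by
    have : c2.val d.i = tapeSym w (c2.pos d.i) := by simp [hc2, app]
    rw [this, p2]
  have v2n : c2.val d.i ≠ none := by rw [v2, Ne, tapeSym_eq_none hz]; exact hz0
  set c3 : SC M := app w c2 d.i (if d.l d.i then .backward else .stay) (.w3 d) with hc3
  have p3 : c3.pos d.i = x := by
    by_cases hl : d.l d.i = true
    · rw [if_pos hl] at hx
      have : c3.pos d.i = movePos k (c2.pos d.i) .backward := by simp [hc3, app, hl, hkdef]
      rw [this, p2, hx.2, movePos_one_b, hx.1]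
    · rw [if_neg hl] at hx
      have : c3.pos d.i = movePos k (c2.pos d.i) .stay := by simp [hc3, app, hl, hkdef]
      rw [this, p2, hx]; rfl
  have v3 : c3.val d.i = tapeSym w x := by
    by_cases hl : d.l d.i = true
    · have : c3.val d.i = tapeSym w (c3.pos d.i) := by simp [hc3, app, hl]
      rw [this, p3]
    · rw [if_neg hl] at hx
      have : c3.val d.i = c2.val d.i := by simp [hc3, app, hl]
      rw [this, v2, hx]
  set c4 : SC M := app w c3 d.i (d.mv d.i) (.w4 d) with hc4
  have p4 : c4.pos d.i = movePos k x (d.mv d.i) := by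
    have : c4.pos d.i = movePos k (c3.pos d.i) (d.mv d.i) := by simp [hc4, app, hkdef]
    rw [this, p3]
  have v4 : c4.val d.i = tapeSym w (movePos k x (d.mv d.i)) := by
    by_cases hm : d.mv d.i = .stay
    · have : c4.val d.i = c3.val d.i := by simp [hc4, app, hm]
      rw [this, v3, hm]; rfl
    · have : c4.val d.i = tapeSym w (c4.pos d.i) := by simp [hc4, app, hm]
      rw [this, p4]
  set y := movePos k x (d.mv d.i) with hy
  have hylt : y < k + 1 := movePos_lt _ hxlt
  set c5 : SC M := app w c4 d.i (if c4.val d.i = none then .forward else .stay)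
      (nextPtr (upd d (c4.val d.i))) with hc5
  have p5 : c5.pos d.i = movePos k y (if c4.val d.i = none then .forward else .stay) := by
    have : c5.pos d.i = movePos k (c4.pos d.i) (if c4.val d.i = none then .forward else .stay) := by
      simp [hc5, app, hkdef]
    rw [this, p4]
  refine ⟨c5, ?_, ?_, ?_, ?_⟩
  · exact .head (det_w0 c d h) (.head (det_w1 c1 d rfl) (.head (det_w2 c2 d rfl v2n)
      (.head (det_w3 c3 d rfl) (.head (det_w4 c4 d rfl) .refl))))
  · rw [← v4]; rfl
  · intro j hj
    rw [hc5, app_pos_ne _ _ _ hj, hc4, app_pos_ne _ _ _ hj, hc3, app_pos_ne _ _ _ hj, hc2,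
      app_pos_ne _ _ _ hj, hc1, app_pos_ne _ _ _ hj]
  · rw [p5, v4]
    by_cases hy0 : y = 0
    · have hn : tapeSym w y = none := (tapeSym_eq_none hylt).2 hy0
      rw [if_pos hn, hy0, movePos_zero_f hk]
      rw [hy0] at hn
      exact ⟨by omega, by omega, by simp [hn]⟩
    · have hn : ¬ tapeSym w y = none := fun hh => hy0 ((tapeSym_eq_none hylt).1 hh)
      rw [if_neg hn]
      exact ⟨hylt, hy0, by simp [hn, movePos]⟩

/-- Relation at nodes (nonempty word). -/
def RN (w : List Bool) (x : PConfig (n + 2) M.Q) (z : SC M) : Prop :=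
  1 ≤ w.length ∧ ∃ l, z.state = .node x.val l x.state ∧
    ∀ j, PR w.length (x.pos j) (z.pos j) (l j)

theorem round_path (hk : 1 ≤ w.length) (x : PConfig (n + 2) M.Q) (mv : Fin (n + 2) → Move) (q : M.Q) :
    ∀ (k : ℕ) (c : SC M) (d : WD n M.Q), d.i.1 + k = n + 1 → c.state = .w0 d → d.mv = mv → d.q = q →
      (∀ j, d.e j = if j < d.i then (mapp w x mv q).val j else x.val j) →
      (∀ j, PR w.length (if j < d.i then (mapp w x mv q).pos j else x.pos j) (c.pos j) (d.l j)) →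
      ∃ z', Path M w c z' ∧ RN w (mapp w x mv q) z' := by
  intro k
  induction k with
  | zero =>
    intro c d hd h hmv hq he hp
    obtain ⟨c', hpath, hst, hoth, hself⟩ := ptr_path hk c d h (x.pos d.i) (by simpa using hp d.i)
    refine ⟨c', hpath, hk, (upd d (tapeSym w (movePos w.length (x.pos d.i) (d.mv d.i)))).l, ?_, ?_⟩
    · rw [hst, nextPtr_last _ (by simp [upd]; omega)]
      congr 1
      funext j
      by_cases hj : j = d.i
      · subst hj; subst hmv
        have := he d.i
        simp at this
        simp [upd, mapp, this]
      · have hlt : j < d.i := by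
          have := j.2
          have : j.1 ≠ d.i.1 := fun hh => hj (Fin.ext hh)
          exact Fin.lt_def.2 (by omega)
        have := he j
        rw [if_pos hlt] at this
        simp [upd, hj, this]
    · intro j
      by_cases hj : j = d.i
      · subst hj; subst hmv
        simpa [upd, mapp] using hself
      · have hlt : j < d.i := by
          have := j.2
          have : j.1 ≠ d.i.1 := fun hh => hj (Fin.ext hh)
          exact Fin.lt_def.2 (by omega)
        have := hp j
        rw [if_pos hlt] at this
        simpa [upd, hj, hoth j hj] using this
  | succ k ih =>
    intro c d hd h hmv hq he hp
    obtain ⟨c', hpath, hst, hoth, hself⟩ := ptr_path hk c d h (x.pos d.i) (by simpa using hp d.i)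
    have hlt' : d.i.1 + 1 < n + 2 := by omega
    rw [nextPtr_lt _ (by simpa [upd] using hlt')] at hst
    have hcmp : ∀ j : Fin (n + 2), j ≠ d.i → ((j < (⟨d.i.1 + 1, hlt'⟩ : Fin (n + 2))) ↔ j < d.i) := by
      intro j hj
      have : j.1 ≠ d.i.1 := fun hh => hj (Fin.ext hh)
      simp only [Fin.lt_def]; omega
    have hself' : d.i < (⟨d.i.1 + 1, hlt'⟩ : Fin (n + 2)) := by simp [Fin.lt_def]
    suffices hh : _ ∧ _ by
      obtain ⟨z', hz', hR⟩ := ih c' _ (by simp [upd]; omega) hst hmv hq hh.1 hh.2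
      exact ⟨z', hpath.trans hz', hR⟩
    constructor
    · intro j
      by_cases hj : j = d.i
      · subst hj; subst hmv
        have := he d.i
        simp at this
        simp [upd, mapp, this, hself']
      · have := he j
        simp only [upd, hj, if_false, hcmp j hj]
        exact this
    · intro j
      by_cases hj : j = d.i
      · subst hj; subst hmv
        simpa [upd, mapp, hself'] using hself
      · have := hp j
        simp only [upd, hj, if_false, hcmp j hj, hoth j hj]
        exact this

theorem lift_path : ∀ (k : ℕ) (c : SC M) (d : WD n M.Q), d.i.1 + k = n + 1 → d.i ≠ 0 →
    c.state = .lift d → 1 ≤ w.length →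
    (∀ j, c.pos j = if j < d.i then 1 else 0) →
    ∃ c', Path M w c c' ∧ c'.state = .w0 { d with i := 0 } ∧ ∀ j, c'.pos j = 1 := by
  intro k
  induction k with
  | zero =>
    intro c d hd hd0 h hk hp
    refine ⟨_, .single (det_lift c d h hd0), ?_, ?_⟩
    · simp only [app, nextLift]; rw [dif_neg (by omega)]
    · intro j
      by_cases hj : j = d.i
      · subst hj
        have := hp d.i
        simp at this
        simp [app, this, movePos_zero_f hk]
      · have hlt : j < d.i := by
          have := j.2
          have : j.1 ≠ d.i.1 := fun hh => hj (Fin.ext hh)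
          exact Fin.lt_def.2 (by omega)
        rw [app_pos_ne _ _ _ hj, hp j, if_pos hlt]
  | succ k ih =>
    intro c d hd hd0 h hk hp
    have hlt' : d.i.1 + 1 < n + 2 := by omega
    suffices hh : _ by
      obtain ⟨c', h1, h2, h3⟩ := ih (app w c d.i .forward (nextLift d))
        { d with i := ⟨d.i.1 + 1, hlt'⟩ } (show d.i.1 + 1 + k = n + 1 by omega)
        (fun hh => by have := congrArg Fin.val hh; simp at this)
        (by simp only [app, nextLift]; rw [dif_pos hlt']) hk hh
      exact ⟨c', .head (det_lift c d h hd0) h1, h2, h3⟩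
    · intro j
      by_cases hj : j = d.i
      · subst hj
        have := hp d.i
        simp at this
        simp [app, this, movePos_zero_f hk, Fin.lt_def]
      · have : j.1 ≠ d.i.1 := fun hh => hj (Fin.ext hh)
        have hcmp : (j < (⟨d.i.1 + 1, hlt'⟩ : Fin (n + 2))) ↔ j < d.i := by
          simp only [Fin.lt_def]; omega
        rw [app_pos_ne _ _ _ hj, hp j]
        simp only [hcmp]

/-- Relation at the initial states. -/
def RI (x : PConfig (n + 2) M.Q) (z : SC M) : Prop :=
  z.state = .boot x.val x.state ∧ (∀ j, x.pos j = 0) ∧ ∀ j, z.pos j = 0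

def R (w : List Bool) (x : PConfig (n + 2) M.Q) (z : SC M) : Prop := RI x z ∨ RN w x z

theorem init_path (x : PConfig (n + 2) M.Q) (z : SC M) (hR : RI x z) (mv q) :
    ∃ z', Path M w (app w z 0 .forward (.l1 x.val mv q)) z' ∧ R w (mapp w x mv q) z' := by
  obtain ⟨hs, hx, hz⟩ := hR
  set c : SC M := app w z 0 .forward (.l1 x.val mv q) with hc
  have hv : c.val 0 = tapeSym w (movePos w.length 0 .forward) := by simp [hc, app, hz]
  rcases Nat.eq_zero_or_pos w.length with hk | hk
  · have hv' : c.val 0 = none := by simp [hv, tapeSym, hk, Nat.mod_one]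
    have hdet := det_l1 (w := w) c x.val mv q rfl
    rw [if_pos hv'] at hdet
    refine ⟨_, .single hdet, .inl ⟨?_, ?_, ?_⟩⟩
    · simp only [app, mapp]
      congr 1
      funext j
      simp [eps, tapeSym, hk, Nat.mod_one]
    · intro j
      have := movePos_lt (k := w.length) (z := x.pos j) (mv j) (by rw [hx]; omega)
      simp only [mapp]; omega
    · intro j
      by_cases hj : j = 0
      · subst hj; simp [app, hc, movePos, hk, Nat.mod_one]
      · simp [app, hc, hj, hz]
  · have hv' : c.val 0 ≠ none := by
      rw [hv, movePos_zero_f hk, Ne, tapeSym_eq_none (by omega)]; omega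
    have hdet := det_l1 (w := w) c x.val mv q rfl
    rw [if_neg hv'] at hdet
    obtain ⟨c', h1, h2, h3⟩ := lift_path (w := w) n
      (app w c 0 .stay (.lift ⟨1, x.val, fun _ => true, mv, q⟩))
      ⟨1, x.val, fun _ => true, mv, q⟩ (by simp; omega) (by simp) rfl hk (by
        intro j
        by_cases hj : j = 0
        · subst hj; simp [app, hc, movePos, hz]; omega
        · have : ¬ j < 1 := by rw [Fin.lt_one_iff]; exact hj
          simp [app, hc, hj, hz])
    obtain ⟨z', h4, h5⟩ := round_path hk x mv q (n + 1) c' _ (by simp) h2 rfl rfl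
      (by intro j; simp) (by
        intro j
        simp only [Fin.not_lt_zero, if_false, h3 j, hx j]
        exact ⟨by omega, by omega, by simp⟩)
    exact ⟨z', .head hdet (h1.trans h4), .inr h5⟩

theorem node_path (x : PConfig (n + 2) M.Q) (z : SC M) (hk : 1 ≤ w.length) (l)
    (hp : ∀ j, PR w.length (x.pos j) (z.pos j) (l j)) (mv q) :
    ∃ z', Path M w (app w z 0 .stay (.w0 ⟨0, x.val, l, mv, q⟩)) z' ∧ R w (mapp w x mv q) z' := by
  obtain ⟨z', h4, h5⟩ := round_path hk x mv q (n + 1)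
      (app w z 0 .stay (.w0 ⟨0, x.val, l, mv, q⟩)) ⟨0, x.val, l, mv, q⟩ (by simp) rfl rfl rfl
      (by intro j; simp) (by
        intro j
        simp only [Fin.not_lt_zero, if_false]
        have : (app w z 0 .stay (.w0 ⟨0, x.val, l, mv, q⟩) : SC M).pos j = z.pos j := by
          by_cases hj : j = 0 <;> simp [app, hj, movePos]
        rw [this]; exact hp j)
  exact ⟨z', h4, .inr h5⟩

theorem sim_halts (x : PConfig (n + 2) M.Q) (z : SC M) (hR : R w x z) :
    Halts M w x ↔ SHalts M w z := by
  refine bisim (R w) ?_ ?_ x z hR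
  · intro x z x' hR hs
    obtain ⟨mv, q, ht, rfl⟩ := (step_iff _ _ _ _).1 hs
    rcases hR with hR | ⟨hk, l, hst, hp⟩
    · obtain ⟨z', h1, h2⟩ := init_path (w := w) x z hR mv q
      exact ⟨_, z', (sstep_iff _ _ _ _).2 ⟨0, .forward, _, by
        rw [hR.1]; exact ⟨mv, q, ht, rfl, rfl, rfl⟩, rfl⟩, h1, h2⟩
    · obtain ⟨z', h1, h2⟩ := node_path (w := w) x z hk l hp mv q
      exact ⟨_, z', (sstep_iff _ _ _ _).2 ⟨0, .stay, _, by
        rw [hst]; exact ⟨mv, q, ht, rfl, rfl, rfl⟩, rfl⟩, h1, h2⟩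
  · intro x z c hR hs
    obtain ⟨i, m, s', ht, rfl⟩ := (sstep_iff _ _ _ _).1 hs
    rcases hR with hR | ⟨hk, l, hst, hp⟩
    · rw [hR.1] at ht
      obtain ⟨mv, q, ht, rfl, rfl, rfl⟩ := ht
      obtain ⟨z', h1, h2⟩ := init_path (w := w) x z hR mv q
      exact ⟨_, z', (step_iff _ _ _ _).2 ⟨mv, q, ht, rfl⟩, h1, h2⟩
    · rw [hst] at ht
      obtain ⟨mv, q, ht, rfl, rfl, rfl⟩ := ht
      obtain ⟨z', h1, h2⟩ := node_path (w := w) x z hk l hp mv q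
      exact ⟨_, z', (step_iff _ _ _ _).2 ⟨mv, q, ht, rfl⟩, h1, h2⟩

end steps

theorem sim_accepts (M : NDPM (n + 2)) (c w) :
    (sim M).Accepts c w ↔ SHalts M w ((sim M).initConfig c) :=
  accepts_iff (sim M) (fun _ h => h) c w

/-- Every start of `sim M` either behaves as a start of `M` or accepts everything. -/
theorem sim_start (M : NDPM (n + 2)) (hM : ∀ pc, ¬ M.trans pc (.inr false))
    (v : Fin (n + 2) → Option Bool) (s : St n M.Q) :
    (∃ c, ∀ w, (sim M).Accepts (v, s) w ↔ M.Accepts c w) ∨ ∀ w, (sim M).Accepts (v, s) w := by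
  have work : ∀ d : WD n M.Q, (s = .w0 d ∨ s = .w1 d ∨ s = .w2 d ∨ s = .w3 d ∨ s = .w4 d) →
      ∀ w, (sim M).Accepts (v, s) w := by
    intro d h w
    rw [sim_accepts]
    obtain ⟨j, hj⟩ := exists_ne d.i
    exact bad_work j _ d hj rfl h
  have lift : ∀ (w) (d : WD n M.Q) (c : SC M), c.pos 0 = 0 → c.state = .lift d → SHalts M w c := by
    intro w d c h0 h
    have := d.i.2
    exact bad_lift (n + 1 - d.i.1) c d (by omega) h0 h
  match s, work with
  | .boot e q, _ =>
    left
    refine ⟨(e, q), fun w => ?_⟩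
    rw [sim_accepts, accepts_iff M hM]
    exact (sim_halts _ _ (.inl ⟨rfl, fun _ => rfl, fun _ => rfl⟩)).symm
  | .l1 e mv q, _ =>
    by_cases hv : v 0 = none
    · left
      refine ⟨(eps e mv, q), fun w => ?_⟩
      rw [sim_accepts, accepts_iff M hM]
      have hdet := det_l1 (w := w) ((sim M).initConfig (v, .l1 e mv q) : SC M) e mv q rfl
      rw [if_pos (show ((sim M).initConfig (v, .l1 e mv q)).val 0 = none from hv)] at hdet
      have hp := Relation.ReflTransGen.single hdet
      refine Iff.trans ⟨halts_of_path hp, path_halts hp⟩ (sim_halts _ _ (.inl ⟨rfl, fun _ => rfl, ?_⟩)).symm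
      intro j
      by_cases hj : j = 0 <;> simp [app, hj, movePos, NDPM.initConfig]
    · right
      intro w
      rw [sim_accepts]
      have hdet := det_l1 (w := w) ((sim M).initConfig (v, .l1 e mv q) : SC M) e mv q rfl
      rw [if_neg (show ¬ ((sim M).initConfig (v, .l1 e mv q)).val 0 = none from hv)] at hdet
      refine halts_of_det hdet (lift w _ _ ?_ rfl)
      simp [app, movePos, NDPM.initConfig]
  | .lift d, _ => right; intro w; rw [sim_accepts]; exact lift w d _ rfl rfl
  | .w0 d, work => exact .inr (work d (by simp))
  | .w1 d, work => exact .inr (work d (by simp))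
  | .w2 d, work => exact .inr (work d (by simp))
  | .w3 d, work => exact .inr (work d (by simp))
  | .w4 d, work => exact .inr (work d (by simp))
  | .node e l q, _ => right; intro w; rw [sim_accepts]; exact bad_node 0 _ e l q rfl rfl

theorem sim_init (M : NDPM (n + 2)) (hM : ∀ pc, ¬ M.trans pc (.inr false)) (c w) :
    (sim M).Accepts (c.1, St.boot c.1 c.2) w ↔ M.Accepts c w := by
  rw [sim_accepts, accepts_iff M hM]
  exact (sim_halts _ _ (.inl ⟨rfl, fun _ => rfl, fun _ => rfl⟩)).symm

/-- Replace rejection by an infinite loop. -/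
def noRej {p : ℕ} (M : NDPM p) : NDPM p where
  Q := M.Q
  finQ := M.finQ
  trans := fun pc t => match t with
    | .inl x => M.trans pc (.inl x) ∨ (M.trans pc (.inr false) ∧ x = (fun _ => .stay, pc.2))
    | .inr _ => False

theorem mapp_stay {p : ℕ} (w : List Bool) (c : PConfig p Q) :
    mapp w c (fun _ => .stay) c.state = c := by
  apply PConfig_ext <;> simp [mapp, movePos]

theorem noRej_accepts {p : ℕ} (M : NDPM p) (c w) : (noRej M).Accepts c w ↔ M.Accepts c w := by
  have hstep : ∀ a b : PConfig p M.Q, (noRej M).Step w a b ↔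
      M.Step w a b ∨ (M.trans (a.val, a.state) (.inr false) ∧ b = a) := by
    intro a b
    refine (step_iff (noRej M) w a b).trans ?_
    rw [step_iff]
    constructor
    · rintro ⟨mv, q, h | ⟨h, h'⟩, rfl⟩
      · exact .inl ⟨mv, q, h, rfl⟩
      · simp at h'
        obtain ⟨rfl, rfl⟩ := h'
        exact .inr ⟨h, mapp_stay w a⟩
    · rintro (⟨mv, q, h, rfl⟩ | ⟨h, rfl⟩)
      · exact ⟨mv, q, .inl h, rfl⟩
      · exact ⟨_, _, .inr ⟨h, rfl⟩, (mapp_stay (Q := M.Q) w b).symm⟩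
  rw [accepts_iff (noRej M) (fun _ h => h)]
  constructor
  · intro h
    refine ⟨?_, ?_⟩
    · rintro ⟨f, h0, hf⟩
      have := acc_iff_isEmpty_descending_chain.1 h
      exact this.false ⟨f, h0, fun m => (hstep _ _).2 (.inl (hf m))⟩
    · rintro ⟨d, hd, hr⟩
      have hd' : Halts (noRej M) w d := by
        clear hr
        induction hd with
        | refl => exact h
        | tail _ hs ih => exact ih.inv ((hstep _ _).2 (.inl hs))
      have irr : ∀ d, Halts (noRej M) w d → ¬ (noRej M).Step w d d := by
        intro d hd
        induction hd with
        | intro d _ ih => exact fun hs => ih d hs hs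
      exact irr d hd' ((hstep _ _).2 (.inr ⟨hr, rfl⟩))
  · rintro ⟨h1, h2⟩
    refine acc_iff_isEmpty_descending_chain.2 ⟨?_⟩
    rintro ⟨f, h0, hf⟩
    have hf' : ∀ m, (noRej M).Step w (f m) (f (m + 1)) := hf
    have key : ∀ m, Relation.ReflTransGen (M.Step w) (M.initConfig c) (f m) ∧
        M.Step w (f m) (f (m + 1)) := by
      intro m
      have fin : Relation.ReflTransGen (M.Step w) (M.initConfig c) (f m) →
          M.Step w (f m) (f (m + 1)) := by
        intro hr
        rcases (hstep _ _).1 (hf' m) with h | ⟨h, _⟩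
        · exact h
        · exact (h2 ⟨_, hr, h⟩).elim
      have : Relation.ReflTransGen (M.Step w) (M.initConfig c) (f m) := by
        clear fin
        induction m with
        | zero => rw [h0]; exact .refl
        | succ m ih =>
          rcases (hstep _ _).1 (hf' m) with h | ⟨h, _⟩
          · exact ih.tail h
          · exact (h2 ⟨_, ih, h⟩).elim
      exact ⟨this, fin this⟩
    exact h1 ⟨f, h0, fun m => (key m).2⟩

/-- The machine that always loops. -/
def loopM {p : ℕ} (M : NDPM p) : NDPM p where
  Q := M.Q
  finQ := M.finQ
  trans := fun pc t => t = .inl (fun _ => .stay, pc.2)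

theorem loopM_not_accepts {p : ℕ} (M : NDPM p) (c w) : ¬ (loopM M).Accepts c w := by
  rintro ⟨h, _⟩
  refine h ⟨fun _ => (loopM M).initConfig c, rfl, fun _ => (step_iff _ _ _ _).2 ?_⟩
  exact ⟨_, _, rfl, (mapp_stay _ _).symm⟩

/-- If `M` (without rejection) does not decide the set of all words then it never accepts. -/
theorem not_accepts {p : ℕ} (M : NDPM p) (hM : ∀ pc, ¬ M.trans pc (.inr false))
    (h : ¬ M.Decides Set.univ) (c w) : ¬ M.Accepts c w := by
  have hsucc : ∀ w (d : PConfig p M.Q), ∃ d', M.Step w d d' := by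
    intro w d
    by_contra hno
    push Not at hno
    apply h
    refine ⟨(d.val, d.state), fun w' => ?_⟩
    rw [accepts_iff M hM]
    simp only [Set.mem_univ, iff_true]
    refine ⟨_, fun y hy => ?_⟩
    obtain ⟨mv, q, ht, -⟩ := (step_iff _ _ _ _).1 hy
    exact (hno _ ((step_iff _ _ _ _).2 ⟨mv, q, ht, rfl⟩)).elim
  rw [accepts_iff M hM]
  intro hacc
  have : ∀ d, Halts M w d → False := by
    intro d hd
    induction hd with
    | intro d _ ih => obtain ⟨d', hd'⟩ := hsucc w d; exact ih d' hd'
  exact this _ hacc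

end OneMove

/-- for every NDPM `M` with `p` pointers there is an NDPM `M'` with `p`
pointers in which every transition moves at most one pointer (at most one instruction
differs from `stay`), and which decides exactly the same sets of binary words as `M`. -/
theorem one_movement_at_a_time {p : ℕ} (M : NDPM p) :
    ∃ M' : NDPM p,
      (∀ (pc : (Fin p → Option Bool) × M'.Q) (mv : Fin p → Move) (q' : M'.Q),
        M'.trans pc (Sum.inl (mv, q')) →
        ∀ i j : Fin p, mv i ≠ Move.stay → mv j ≠ Move.stay → i = j) ∧
      (∀ S : Set (List Bool), M.Decides S ↔ M'.Decides S) := by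
  rcases lt_or_ge p 2 with hp | hp
  · refine ⟨M, fun _ _ _ _ i j _ _ => Fin.ext (by have := i.2; have := j.2; omega), fun _ => Iff.rfl⟩
  obtain ⟨n, rfl⟩ : ∃ n, p = n + 2 := ⟨p - 2, by omega⟩
  have hdec : ∀ S, M.Decides S ↔ (OneMove.noRej M).Decides S := by
    intro S
    exact exists_congr fun c => forall_congr' fun w => by rw [← OneMove.noRej_accepts M c w]
  have hN : ∀ pc, ¬ (OneMove.noRej M).trans pc (.inr false) := fun _ h => h
  generalize OneMove.noRej M = N at hdec hN
  simp only [hdec]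
  clear hdec
  by_cases hu : N.Decides Set.univ
  · refine ⟨OneMove.sim N, ?_, ?_⟩
    · rintro pc mv q' ⟨a, m, rfl, -⟩ i j hi hj
      have key : ∀ i, OneMove.single a m i ≠ Move.stay → i = a := by
        intro i hi
        by_contra hne
        exact hi (by simp [OneMove.single, hne])
      rw [key i hi, key j hj]
    · intro S
      constructor
      · rintro ⟨c, hc⟩
        exact ⟨(c.1, .boot c.1 c.2), fun w => (OneMove.sim_init N hN c w).trans (hc w)⟩
      · rintro ⟨⟨v, s⟩, hc⟩
        rcases OneMove.sim_start N hN v s with ⟨c, h⟩ | h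
        · exact ⟨c, fun w => (h w).symm.trans (hc w)⟩
        · have : S = Set.univ := Set.eq_univ_of_forall fun w => (hc w).1 (h w)
          rw [this]; exact hu
  · refine ⟨OneMove.loopM N, ?_, ?_⟩
    · intro pc mv q' h i j hi
      have h' := Sum.inl.inj h
      have := congrArg Prod.fst h'
      simp only at this
      rw [this] at hi
      exact (hi rfl).elim
    · intro S
      refine exists_congr fun c => forall_congr' fun w => ?_
      have h1 := OneMove.not_accepts N hN hu c w
      have h2 := OneMove.loopM_not_accepts N c w
      simp only [h1, h2]
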